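/- arXiv:0905.0087 — 6 statements merged into one kernel-verified Lean document; each statement's English description precedes it below -/
import Mathlib

section
/- Let H be a graded connected Hopf algebra over a field k of characteristic zero and A a commutative k-algebra. The convolution exponential exp*(α) = Σ_{n≥0} α^{*n}/n! and the convolution logarithm log*(δ+α) = Σ_{n≥1} (−1)^{n−1} α^{*n}/n (both sums being finite on each graded component H_m when α(1) = 0) are mutually inverse bijections between the set g(H,A) of infinitesimal characters and the group G(H,A) of characters. -/
open TensorProduct

noncomputable section

/-- The convolution product `α * β = μ_A ∘ (α ⊗ β) ∘ Δ`. -/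
def conv {k H A : Type} [Field k] [Ring H] [Bialgebra k H]
    [CommRing A] [Algebra k A] (f g : H →ₗ[k] A) : H →ₗ[k] A :=
  (LinearMap.mul' k A) ∘ₗ (TensorProduct.map f g) ∘ₗ (Coalgebra.comul (R := k))

/-- The convolution unit `δ = η_A ∘ ε`. -/
def convUnit (k : Type) {H : Type} (A : Type) [Field k] [Ring H] [Bialgebra k H]
    [CommRing A] [Algebra k A] : H →ₗ[k] A :=
  (Algebra.linearMap k A) ∘ₗ (Coalgebra.counit (R := k))

/-- Convolution powers `f^{*n}`, with `f^{*0} = δ`. -/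
def convPow {k H A : Type} [Field k] [Ring H] [Bialgebra k H]
    [CommRing A] [Algebra k A] (f : H →ₗ[k] A) : ℕ → (H →ₗ[k] A)
  | 0 => convUnit k A
  | n + 1 => conv f (convPow f n)

/-- `f` is a unital algebra morphism (an `A`-valued character). -/
def IsChar {k H A : Type} [Field k] [Ring H] [Bialgebra k H]
    [CommRing A] [Algebra k A] (f : H →ₗ[k] A) : Prop :=
  f 1 = 1 ∧ ∀ x y : H, f (x * y) = f x * f y

/-- `f` is an infinitesimal character: `f(xy) = f(x)δ(y) + δ(x)f(y)`. -/
def IsInfChar {k H A : Type} [Field k] [Ring H] [Bialgebra k H]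
    [CommRing A] [Algebra k A] (f : H →ₗ[k] A) : Prop :=
  ∀ x y : H, f (x * y) = f x * convUnit k A y + convUnit k A x * f y

namespace PowerSeries

theorem log_subst_exp_sub_one (K : Type*) [Field K] [CharZero K] :
    (log K).subst (exp K - 1) = X := by
  have hE : HasSubst (exp K - 1) := HasSubst.exp_sub_one
  have hgeom : (1 + X : K⟦X⟧) * d⁄dX K (log K) = 1 := by
    rw [deriv_log]
    ext n
    rw [add_mul, one_mul, map_add]
    cases n with
    | zero => simp
    | succ n => simp [coeff_succ_X_mul, pow_succ, coeff_one]
  have hsub := congrArg (fun f => f.subst (exp K - 1)) hgeom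
  have h1 : (1 : K⟦X⟧).subst (exp K - 1) = (1 : K⟦X⟧) := by
    rw [← coe_substAlgHom hE, map_one]
  simp only [subst_mul hE, subst_add hE, subst_X hE, h1] at hsub
  refine derivative.ext ?_ ?_
  · have hd : d⁄dX K (exp K - 1) = exp K := by simp [derivative_exp]
    rw [derivative_subst hE, derivative_X, hd]
    linear_combination hsub
  · rw [constantCoeff_X]
    exact constantCoeff_subst_eq_zero (by simp [← constantCoeff_eq]) _ constantCoeff_log

theorem exp_sub_one_subst_log (K : Type*) [Field K] [CharZero K] :
    (exp K - 1).subst (log K) = X := by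
  have hE : HasSubst (exp K - 1) := HasSubst.exp_sub_one
  have h0 : constantCoeff (exp K - 1) = 0 := by simp
  have hu : IsUnit (coeff 1 (exp K - 1)) := by simp [coeff_one]
  set Q := (exp K - 1).substInvOfIsUnit hu
  have hQ : HasSubst Q := HasSubst.substInvOfIsUnit _ hu
  have hR : (exp K - 1).subst Q = X := subst_substInvOfIsUnit_right _ h0 hu
  have hlog : log K = Q := by
    rw [← X_subst (log K), ← hR, ← subst_comp_subst_apply hE hQ, log_subst_exp_sub_one,
      subst_X hQ]
  rw [hlog, hR]

theorem X_pow_dvd_subst_sub_trunc_comp_trunc {R : Type*} [CommRing R] (n : ℕ) (f : R⟦X⟧)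
    {g : R⟦X⟧} (hg : constantCoeff g = 0) :
    (Polynomial.X : Polynomial R) ^ n ∣
      trunc n (f.subst g) - (trunc n f).comp (trunc n g) := by
  have hs : HasSubst g := HasSubst.of_constantCoeff_zero' hg
  have hXn (h : R⟦X⟧) : (X : R⟦X⟧) ^ n ∣ h - (trunc n h : R⟦X⟧) :=
    ⟨_, sub_eq_of_eq_add (eq_X_pow_mul_shift_add_trunc n h)⟩
  have hsubst : (X : R⟦X⟧) ^ n ∣ f.subst g - ((trunc n f : Polynomial R) : R⟦X⟧).subst g := by
    obtain ⟨q, hq⟩ := hXn f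
    rw [← subst_sub hs, hq, subst_mul hs, subst_pow hs, subst_X hs]
    exact Dvd.dvd.mul_right (pow_dvd_pow_of_dvd (X_dvd_iff.mpr hg) n) _
  have hpoly : (X : R⟦X⟧) ^ n ∣ ((trunc n f : Polynomial R) : R⟦X⟧).subst g -
      (((trunc n f).comp (trunc n g) : Polynomial R) : R⟦X⟧) := by
    have hc : (((trunc n f).comp (trunc n g) : Polynomial R) : R⟦X⟧) =
        Polynomial.aeval ((trunc n g : Polynomial R) : R⟦X⟧) (trunc n f) := by
      rw [← Polynomial.coeToPowerSeries.ringHom_apply, Polynomial.comp, Polynomial.hom_eval₂,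
        Polynomial.aeval_def]
      congr 1
      ext r : 1
      simp
    rw [subst_coe hs, hc, Polynomial.aeval_def, Polynomial.aeval_def, Polynomial.eval₂_eq_eval_map,
      Polynomial.eval₂_eq_eval_map]
    exact (hXn g).trans (Polynomial.sub_dvd_eval_sub _ _ _)
  have h := (hsubst.add hpoly).sub (hXn (f.subst g))
  rw [X_pow_dvd_iff] at h
  rw [Polynomial.X_pow_dvd_iff]
  intro d hd
  simpa using h d hd

end PowerSeries

theorem Finset.sum_range_antidiagonal_mul_of_eq_zero {R : Type*}
    [NonUnitalNonAssocSemiring R]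
    {p q : ℕ} {a b : ℕ → R} (ha : ∀ i, p < i → a i = 0) (hb : ∀ j, q < j → b j = 0) :
    ∑ n ∈ Finset.range (p + q + 1), ∑ ij ∈ Finset.HasAntidiagonal.antidiagonal n, a ij.1 * b ij.2 =
      (∑ i ∈ Finset.range (p + 1), a i) * ∑ j ∈ Finset.range (q + 1), b j := by
  rw [Finset.sum_mul_sum, ← Finset.sum_product',
    ← Finset.sum_fiberwise_of_maps_to (g := fun ij : ℕ × ℕ => ij.1 + ij.2)
      (t := Finset.range (p + q + 1))]
  · refine Finset.sum_congr rfl fun n _ => (Finset.sum_subset ?_ ?_).symm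
    · intro ij hij
      simpa using (Finset.mem_filter.mp hij).2
    · intro ij hij hn
      simp only [Finset.mem_filter, Finset.mem_product, Finset.mem_range,
        Finset.HasAntidiagonal.mem_antidiagonal] at hij hn
      rcases lt_or_ge p ij.1 with h | h
      · rw [ha _ h, zero_mul]
      · rw [hb _ (by omega), mul_zero]
  · intro ij hij
    simp only [Finset.mem_product, Finset.mem_range] at hij ⊢
    omega

theorem Polynomial.eq_zero_of_forall_eval_natCast_eq_zero (k : Type*) {A : Type*} [Field k]
    [CharZero k] [CommRing A] [Algebra k A] {P : Polynomial A}
    (h : ∀ N : ℕ, P.eval (N : A) = 0) : P = 0 := by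
  ext i
  rw [Polynomial.coeff_zero, ← Module.forall_dual_apply_eq_zero_iff k]
  intro φ
  set Q : Polynomial k :=
    ∑ i ∈ Finset.range (P.natDegree + 1), Polynomial.monomial i (φ (P.coeff i)) with hQ
  have heval (N : ℕ) : Q.eval (N : k) = 0 := by
    rw [← map_zero φ, ← h N, P.eval_eq_sum_range, map_sum, hQ, Polynomial.eval_finsetSum]
    refine Finset.sum_congr rfl fun i _ => ?_
    rw [Polynomial.eval_monomial, mul_comm (P.coeff i), ← map_natCast (algebraMap k A), ← map_pow,
      ← Algebra.smul_def, map_smul, smul_eq_mul, mul_comm]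
  have hQ0 : Q = 0 := Polynomial.eq_zero_of_infinite_isRoot Q
    ((Set.infinite_range_of_injective Nat.cast_injective).mono
      (by rintro _ ⟨N, rfl⟩; exact heval N))
  by_cases hi : i < P.natDegree + 1
  · have := congrArg (Polynomial.coeff · i) hQ0
    simpa [hQ, Polynomial.finsetSum_coeff, Polynomial.coeff_monomial, hi] using this
  · rw [Polynomial.coeff_eq_zero_of_natDegree_lt (by omega), map_zero]

theorem LinearMap.ext_of_decomposition₂ {k H A : Type*} [Field k] [AddCommGroup H]
    [Module k H] [AddCommGroup A] [Module k A] (ℋ : ℕ → Submodule k H)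
    [DirectSum.Decomposition ℋ] {B B' : H →ₗ[k] H →ₗ[k] A}
    (h : ∀ p q : ℕ, ∀ x ∈ ℋ p, ∀ y ∈ ℋ q, B x y = B' x y) : B = B' := by
  ext x y
  induction x using DirectSum.Decomposition.inductionOn ℋ with
  | zero => simp
  | add x x' hx hx' => simp [hx, hx']
  | homogeneous x =>
    induction y using DirectSum.Decomposition.inductionOn ℋ with
    | zero => simp
    | add y y' hy hy' => simp [hy, hy']
    | homogeneous y => exact h _ _ _ x.2 _ y.2

namespace WithConv

open PowerSeries

section Coalgebra

variable {k C A : Type} [Field k] [AddCommGroup C] [Module k C]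
  [CommRing A] [Algebra k A] {ℋ : ℕ → Submodule k C}

/-- The linear maps that vanish on the components of degree less than `n`. -/
def vanishBelow (A : Type) [CommRing A] [Algebra k A] (ℋ : ℕ → Submodule k C) (n : ℕ) :
    Submodule k (WithConv (C →ₗ[k] A)) where
  carrier := {F | ∀ j < n, ∀ x ∈ ℋ j, F x = 0}
  add_mem' hF hG j hj x hx := by simp [hF j hj x hx, hG j hj x hx]
  zero_mem' _ _ _ _ := rfl
  smul_mem' c F hF j hj x hx := by simp [hF j hj x hx]

theorem mem_vanishBelow_zero (F : WithConv (C →ₗ[k] A)) : F ∈ vanishBelow A ℋ 0 :=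
  fun _ hj => absurd hj (Nat.not_lt_zero _)

variable [Coalgebra k C]

/-- The coproduct respects the family `ℋ`. -/
def IsGradedComul (ℋ : ℕ → Submodule k C) : Prop :=
  ∀ n : ℕ, ∀ x ∈ ℋ n, Coalgebra.comul (R := k) x ∈
    ⨆ (pq : ℕ × ℕ) (_ : pq.1 + pq.2 = n),
      LinearMap.range (TensorProduct.mapIncl (ℋ pq.1) (ℋ pq.2))

theorem aeval_trunc_apply (U : WithConv (C →ₗ[k] A)) (f : k⟦X⟧) (n : ℕ) (x : C) :
    Polynomial.aeval U (trunc n f) x = ∑ i ∈ Finset.range n, coeff i f • (U ^ i) x := by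
  rw [Polynomial.aeval_def, eval₂_trunc_eq_sum_range]
  simp [← Algebra.smul_def, ofConv_sum]

variable (hℋ : IsGradedComul ℋ)
include hℋ

theorem mul_mem_vanishBelow {a b : ℕ} {F G : WithConv (C →ₗ[k] A)}
    (hF : F ∈ vanishBelow A ℋ a) (hG : G ∈ vanishBelow A ℋ b) :
    F * G ∈ vanishBelow A ℋ (a + b) := by
  intro j hj x hx
  have hle : (⨆ (pq : ℕ × ℕ) (_ : pq.1 + pq.2 = j),
      LinearMap.range (TensorProduct.mapIncl (ℋ pq.1) (ℋ pq.2))) ≤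
      LinearMap.ker (LinearMap.mul' k A ∘ₗ TensorProduct.map F.ofConv G.ofConv) := by
    refine iSup₂_le fun pq hpq => ?_
    rw [LinearMap.range_le_ker_iff]
    refine TensorProduct.ext' fun y z => ?_
    rcases lt_or_ge pq.1 a with hp | hp
    · simp [TensorProduct.mapIncl, hF _ hp y y.2]
    · simp [TensorProduct.mapIncl, hG pq.2 (by omega) z z.2]
  exact hle (hℋ j x hx)

theorem pow_mem_vanishBelow {F : WithConv (C →ₗ[k] A)} (hF : F ∈ vanishBelow A ℋ 1) (n : ℕ) :
    F ^ n ∈ vanishBelow A ℋ n := by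
  induction n with
  | zero => exact mem_vanishBelow_zero _
  | succ n ih => exact pow_succ F n ▸ mul_mem_vanishBelow hℋ ih hF

theorem pow_sub_pow_mem_vanishBelow {n : ℕ} {F G : WithConv (C →ₗ[k] A)}
    (h : F - G ∈ vanishBelow A ℋ n) (i : ℕ) : F ^ i - G ^ i ∈ vanishBelow A ℋ n := by
  induction i with
  | zero => simp
  | succ i ih =>
    have he : F ^ (i + 1) - G ^ (i + 1) = F ^ i * (F - G) + (F ^ i - G ^ i) * G := by
      simp only [pow_succ]; noncomm_ring
    rw [he]
    refine add_mem ?_ ?_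
    · simpa using mul_mem_vanishBelow hℋ (mem_vanishBelow_zero _) h
    · simpa using mul_mem_vanishBelow hℋ ih (mem_vanishBelow_zero _)

theorem aeval_sub_aeval_mem_vanishBelow {n : ℕ} {F G : WithConv (C →ₗ[k] A)}
    (h : F - G ∈ vanishBelow A ℋ n) (P : Polynomial k) :
    Polynomial.aeval F P - Polynomial.aeval G P ∈ vanishBelow A ℋ n := by
  rw [Polynomial.aeval_eq_sum_range, Polynomial.aeval_eq_sum_range, ← Finset.sum_sub_distrib]
  refine sum_mem fun i _ => ?_
  rw [← smul_sub]
  exact Submodule.smul_mem _ _ (pow_sub_pow_mem_vanishBelow hℋ h i)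

theorem aeval_mem_vanishBelow_of_X_pow_dvd {n : ℕ} {U : WithConv (C →ₗ[k] A)}
    (hU : U ∈ vanishBelow A ℋ 1) {P : Polynomial k} (h : Polynomial.X ^ n ∣ P) :
    Polynomial.aeval U P ∈ vanishBelow A ℋ n := by
  obtain ⟨Q, rfl⟩ := h
  rw [map_mul, map_pow, Polynomial.aeval_X]
  simpa using mul_mem_vanishBelow hℋ (pow_mem_vanishBelow hℋ hU n) (mem_vanishBelow_zero _)

/-- Evaluating a power series degreewise, by truncation, at a map that vanishes in degree `0`. -/
theorem forall_sub_aeval_trunc_mem_iff {F U : WithConv (C →ₗ[k] A)}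
    (hU : U ∈ vanishBelow A ℋ 1) (f : k⟦X⟧) :
    (∀ n, F - Polynomial.aeval U (trunc n f) ∈ vanishBelow A ℋ n) ↔
      ∀ m, ∀ x ∈ ℋ m, F x = ∑ i ∈ Finset.range (m + 1), coeff i f • (U ^ i) x := by
  constructor
  · intro h m x hx
    rw [← aeval_trunc_apply, ← sub_eq_zero]
    exact h (m + 1) m m.lt_succ_self x hx
  · intro h n j hj x hx
    have hd : (Polynomial.X : Polynomial k) ^ (j + 1) ∣ trunc (j + 1) f - trunc n f := by
      rw [Polynomial.X_pow_dvd_iff]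
      intro d hd
      simp [coeff_trunc, hd, show d < n by omega]
    have h0 := aeval_mem_vanishBelow_of_X_pow_dvd hℋ hU hd j j.lt_succ_self x hx
    rw [map_sub] at h0
    have h1 := h j x hx
    rw [← aeval_trunc_apply] at h1
    rw [← h0]
    simp [h1]

theorem aeval_trunc_sub_aeval_trunc_subst_mem {n : ℕ} {F U : WithConv (C →ₗ[k] A)}
    (hU : U ∈ vanishBelow A ℋ 1) (f : k⟦X⟧) {g : k⟦X⟧} (hg : constantCoeff g = 0)
    (h : F - Polynomial.aeval U (trunc n g) ∈ vanishBelow A ℋ n) :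
    Polynomial.aeval F (trunc n f) - Polynomial.aeval U (trunc n (f.subst g)) ∈
      vanishBelow A ℋ n := by
  have h1 := aeval_sub_aeval_mem_vanishBelow hℋ h (trunc n f)
  have h2 := aeval_mem_vanishBelow_of_X_pow_dvd hℋ hU
    (X_pow_dvd_subst_sub_trunc_comp_trunc n f hg)
  rw [← Polynomial.aeval_comp] at h1
  rw [map_sub] at h2
  convert sub_mem h1 h2 using 1
  abel

theorem sub_aeval_trunc_X_mem (n : ℕ) {U : WithConv (C →ₗ[k] A)}
    (hU : U ∈ vanishBelow A ℋ 1) :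
    U - Polynomial.aeval U (trunc n (X : k⟦X⟧)) ∈ vanishBelow A ℋ n := by
  have hd : (Polynomial.X : Polynomial k) ^ n ∣ Polynomial.X - trunc n (X : k⟦X⟧) := by
    rw [Polynomial.X_pow_dvd_iff]
    intro d hd
    simp [coeff_trunc, hd, Polynomial.coeff_X, coeff_X, eq_comm]
  simpa using aeval_mem_vanishBelow_of_X_pow_dvd hℋ hU hd

theorem pow_sub_aeval_trunc_pow_mem {n : ℕ} {F U : WithConv (C →ₗ[k] A)}
    (hU : U ∈ vanishBelow A ℋ 1) (f : k⟦X⟧)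
    (h : F - Polynomial.aeval U (trunc n f) ∈ vanishBelow A ℋ n) (N : ℕ) :
    F ^ N - Polynomial.aeval U (trunc n (f ^ N)) ∈ vanishBelow A ℋ n := by
  have hd : (Polynomial.X : Polynomial k) ^ n ∣ trunc n f ^ N - trunc n (f ^ N) := by
    rw [Polynomial.X_pow_dvd_iff]
    intro d hd
    have := congrArg (Polynomial.coeff · d) (trunc_trunc_pow f n N)
    simp only [coeff_trunc, hd, if_true, ← Polynomial.coe_pow, Polynomial.coeff_coe] at this
    simp [coeff_trunc, hd, this]
  have h1 := pow_sub_pow_mem_vanishBelow hℋ h N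
  have h2 := aeval_mem_vanishBelow_of_X_pow_dvd hℋ hU hd
  rw [map_sub, map_pow] at h2
  convert add_mem h1 h2 using 1
  abel

variable [CharZero k]

theorem sub_aeval_trunc_log_mem {F G : WithConv (C →ₗ[k] A)} (hF : F ∈ vanishBelow A ℋ 1)
    {n : ℕ} (h : G - Polynomial.aeval F (trunc n (exp k)) ∈ vanishBelow A ℋ n) :
    F - Polynomial.aeval (G - 1) (trunc n (log k)) ∈ vanishBelow A ℋ n := by
  cases n with
  | zero => exact mem_vanishBelow_zero _
  | succ n =>
    have h' : G - 1 - Polynomial.aeval F (trunc (n + 1) (exp k - 1)) ∈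
        vanishBelow A ℋ (n + 1) := by
      simpa [trunc_sub, trunc_one] using h
    have h1 := aeval_trunc_sub_aeval_trunc_subst_mem hℋ hF (log k) (by simp) h'
    rw [log_subst_exp_sub_one] at h1
    convert sub_mem (sub_aeval_trunc_X_mem hℋ (n + 1) hF) h1 using 1
    abel

theorem sub_aeval_trunc_exp_mem {F G : WithConv (C →ₗ[k] A)} (hG : G - 1 ∈ vanishBelow A ℋ 1)
    {n : ℕ} (h : F - Polynomial.aeval (G - 1) (trunc n (log k)) ∈ vanishBelow A ℋ n) :
    G - Polynomial.aeval F (trunc n (exp k)) ∈ vanishBelow A ℋ n := by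
  cases n with
  | zero => exact mem_vanishBelow_zero _
  | succ n =>
    have h1 := aeval_trunc_sub_aeval_trunc_subst_mem hℋ hG (exp k - 1) constantCoeff_log h
    rw [exp_sub_one_subst_log, trunc_sub, trunc_one, map_sub, map_one] at h1
    convert sub_mem (sub_aeval_trunc_X_mem hℋ (n + 1) hG) h1 using 1
    abel

end Coalgebra

section Bialgebra

variable {k H A : Type} [Field k] [Ring H] [Bialgebra k H] [CommRing A] [Algebra k A]

theorem convPow_eq (f : H →ₗ[k] A) (n : ℕ) : convPow f n = (toConv f ^ n).ofConv := by
  induction n with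
  | zero => rfl
  | succ n ih => rw [pow_succ', convPow, ih]; rfl

/-- The map `x ⊗ y ↦ F x * G y`. -/
def boxMul (F G : WithConv (H →ₗ[k] A)) : WithConv (H ⊗[k] H →ₗ[k] A) :=
  toConv (LinearMap.mul' k A ∘ₗ TensorProduct.map F.ofConv G.ofConv)

theorem boxMul_apply (F G : WithConv (H →ₗ[k] A)) (x y : H) :
    boxMul F G (x ⊗ₜ y) = F x * G y := rfl

theorem boxMul_mul_boxMul (F G F' G' : WithConv (H →ₗ[k] A)) :
    boxMul F G * boxMul F' G' = boxMul (F * F') (G * G') := by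
  have h := LinearMap.algHom_comp_convMul_distrib (R := k)
    (Algebra.TensorProduct.lmul' k (S := A))
    (toConv (TensorProduct.map F.ofConv G.ofConv)) (toConv (TensorProduct.map F'.ofConv G'.ofConv))
  rw [TensorProduct.map_convMul_map] at h
  exact WithConv.ext h.symm

theorem boxMul_one_one : boxMul (1 : WithConv (H →ₗ[k] A)) 1 = 1 := by
  refine WithConv.ext (TensorProduct.ext' fun x y => ?_)
  simp [boxMul, LinearMap.convOne_def, mul_comm]

theorem boxMul_pow (F G : WithConv (H →ₗ[k] A)) (n : ℕ) :
    boxMul F G ^ n = boxMul (F ^ n) (G ^ n) := by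
  induction n with
  | zero => simp [boxMul_one_one]
  | succ n ih => rw [pow_succ, ih, boxMul_mul_boxMul, pow_succ, pow_succ]

/-- The map `x ⊗ y ↦ F (x * y)`. -/
def compMul (F : WithConv (H →ₗ[k] A)) : WithConv (H ⊗[k] H →ₗ[k] A) :=
  toConv (F.ofConv ∘ₗ (Bialgebra.mulCoalgHom k H).toLinearMap)

theorem compMul_apply (F : WithConv (H →ₗ[k] A)) (x y : H) :
    compMul F (x ⊗ₜ y) = F (x * y) := rfl

theorem compMul_pow (F : WithConv (H →ₗ[k] A)) (n : ℕ) :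
    compMul F ^ n = compMul (F ^ n) := by
  induction n with
  | zero =>
    refine WithConv.ext (TensorProduct.ext' fun x y => ?_)
    simp [compMul, LinearMap.convOne_def, mul_comm]
  | succ n ih =>
    rw [pow_succ, ih, pow_succ]
    exact WithConv.ext (LinearMap.convMul_comp_coalgHom_distrib _ _ _).symm

theorem pow_apply_mul_of_isInfChar {f : H →ₗ[k] A} (hf : IsInfChar f) (n : ℕ) (x y : H) :
    (toConv f ^ n) (x * y) = ∑ ij ∈ Finset.HasAntidiagonal.antidiagonal n,
      (n.choose ij.1 : k) • ((toConv f ^ ij.1) x * (toConv f ^ ij.2) y) := by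
  have h : compMul (toConv f) = boxMul (toConv f) 1 + boxMul 1 (toConv f) :=
    WithConv.ext (TensorProduct.ext' hf)
  have hc : Commute (boxMul (toConv f) 1) (boxMul 1 (toConv f)) := by
    simp [Commute, SemiconjBy, boxMul_mul_boxMul]
  rw [← compMul_apply, ← compMul_pow, h, hc.add_pow']
  simp only [boxMul_pow, one_pow, boxMul_mul_boxMul, mul_one, one_mul, ofConv_sum,
    ← Nat.cast_smul_eq_nsmul k, ofConv_smul, LinearMap.sum_apply, LinearMap.smul_apply,
    boxMul_apply]

theorem pow_apply_mul_of_isChar {g : H →ₗ[k] A} (hg : IsChar g) (n : ℕ) (x y : H) :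
    (toConv g ^ n) (x * y) = (toConv g ^ n) x * (toConv g ^ n) y := by
  have h : compMul (toConv g) = boxMul (toConv g) (toConv g) :=
    WithConv.ext (TensorProduct.ext' hg.2)
  rw [← compMul_apply, ← compMul_pow, h, boxMul_pow, boxMul_apply]

variable {ℋ : ℕ → Submodule k H} (hℋ : IsGradedComul ℋ)
  (hmul : ∀ p q : ℕ, ∀ x ∈ ℋ p, ∀ y ∈ ℋ q, x * y ∈ ℋ (p + q))
  [CharZero k]
include hℋ hmul

theorem isChar_of_exp [DirectSum.Decomposition ℋ] (h1 : (1 : H) ∈ ℋ 0) {f g : H →ₗ[k] A}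
    (hf : IsInfChar f) (hf1 : toConv f ∈ vanishBelow A ℋ 1)
    (h : ∀ m : ℕ, ∀ x ∈ ℋ m,
      g x = ∑ n ∈ Finset.range (m + 1), ((n.factorial : k))⁻¹ • (toConv f ^ n) x) :
    IsChar g := by
  refine ⟨by simp [h 0 1 h1], ?_⟩
  suffices hB : (LinearMap.mul k H).compr₂ g = (LinearMap.mul k A).compl₁₂ g g from
    fun x y => LinearMap.congr_fun₂ hB x y
  refine LinearMap.ext_of_decomposition₂ ℋ fun p q x hx y hy => ?_
  simp only [LinearMap.compr₂_apply, LinearMap.compl₁₂_apply, LinearMap.mul_apply']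
  rw [h _ _ (hmul p q x hx y hy), h p x hx, h q y hy,
    ← Finset.sum_range_antidiagonal_mul_of_eq_zero]
  · refine Finset.sum_congr rfl fun n _ => ?_
    rw [pow_apply_mul_of_isInfChar hf, Finset.smul_sum]
    refine Finset.sum_congr rfl fun ij hij => ?_
    obtain rfl := Finset.HasAntidiagonal.mem_antidiagonal.mp hij
    rw [smul_smul, smul_mul_smul_comm, Nat.cast_add_choose]
    congr 1
    have := Nat.cast_ne_zero (R := k).mpr (ij.1 + ij.2).factorial_ne_zero
    field_simp
  · intro i hi
    rw [pow_mem_vanishBelow hℋ hf1 i p hi x hx, smul_zero]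
  · intro i hi
    rw [pow_mem_vanishBelow hℋ hf1 i q hi y hy, smul_zero]

theorem isInfChar_of_exp [DirectSum.Decomposition ℋ] {f g : H →ₗ[k] A} (hg : IsChar g)
    (hf1 : toConv f ∈ vanishBelow A ℋ 1)
    (h : ∀ n, toConv g - Polynomial.aeval (toConv f) (trunc n (exp k)) ∈ vanishBelow A ℋ n) :
    IsInfChar f := by
  suffices hB : (LinearMap.mul k H).compr₂ f =
      (LinearMap.mul k A).compl₁₂ f (convUnit k A) +
        (LinearMap.mul k A).compl₁₂ (convUnit k A) f from
    fun x y => LinearMap.congr_fun₂ hB x y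
  refine LinearMap.ext_of_decomposition₂ ℋ fun p q x hx y hy => ?_
  simp only [LinearMap.compr₂_apply, LinearMap.compl₁₂_apply, LinearMap.mul_apply',
    LinearMap.add_apply]
  set M := p + q + 2 with hM
  set S : H → Polynomial A := fun z =>
    ∑ i ∈ Finset.range M, Polynomial.monomial i ((i.factorial : k)⁻¹ • (toConv f ^ i) z) with hS
  have hpow (N j : ℕ) (hj : j < M) (z : H) (hz : z ∈ ℋ j) :
      (toConv g ^ N) z = (S z).eval (N : A) := by
    have h0 := pow_sub_aeval_trunc_pow_mem hℋ hf1 (exp k) (h M) N j hj z hz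
    rw [exp_pow_eq_rescale_exp, ofConv_sub, LinearMap.sub_apply, sub_eq_zero] at h0
    rw [h0, aeval_trunc_apply, hS, Polynomial.eval_finsetSum]
    refine Finset.sum_congr rfl fun i _ => ?_
    rw [Polynomial.eval_monomial, coeff_rescale, coeff_exp, mul_smul, mul_comm, Algebra.smul_def]
    simp
  have hS_mul : S (x * y) = S x * S y := by
    rw [← sub_eq_zero]
    refine Polynomial.eq_zero_of_forall_eval_natCast_eq_zero k fun N => ?_
    rw [Polynomial.eval_sub, Polynomial.eval_mul,
      ← hpow N (p + q) (by omega) _ (hmul p q x hx y hy), ← hpow N p (by omega) x hx,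
      ← hpow N q (by omega) y hy, pow_apply_mul_of_isChar hg, sub_self]
  have hcoeff (z : H) (i : ℕ) (hi : i < M) :
      (S z).coeff i = (i.factorial : k)⁻¹ • (toConv f ^ i) z := by
    simp [hS, Polynomial.coeff_monomial, hi]
  have h1 := congrArg (Polynomial.coeff · 1) hS_mul
  simp only [Polynomial.mul_coeff_one] at h1
  rw [hcoeff _ 1 (by omega), hcoeff _ 1 (by omega), hcoeff _ 1 (by omega), hcoeff _ 0 (by omega),
    hcoeff _ 0 (by omega)] at h1
  simp only [Nat.factorial, Nat.cast_one, mul_one, inv_one, one_smul, pow_one,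
    pow_zero] at h1
  rw [h1, add_comm]
  rfl

end Bialgebra

end WithConv

open WithConv

/-- For a graded connected Hopf algebra `H` over a field `k` of
characteristic zero and a commutative `k`-algebra `A`, the convolution exponential
`exp*(α) = ∑ α^{*n}/n!` and logarithm `log*(δ+α) = ∑ (-1)^{n-1} α^{*n}/n` (the sums being
finite on each graded component `H_m` when `α(1) = 0`) are mutually inverse bijections
between the infinitesimal characters `g(H,A)` and the characters `G(H,A)`. -/
theorem convolution_exp_log_bijection
    {k H A : Type} [Field k] [CharZero k] [Ring H] [HopfAlgebra k H]
    [CommRing A] [Algebra k A]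
    (ℋ : ℕ → Submodule k H) [DirectSum.Decomposition ℋ]
    (hmul : ∀ p q : ℕ, ∀ x ∈ ℋ p, ∀ y ∈ ℋ q, x * y ∈ ℋ (p + q))
    (hcomul : ∀ n : ℕ, ∀ x ∈ ℋ n,
      Coalgebra.comul (R := k) x ∈
        ⨆ (pq : ℕ × ℕ) (_ : pq.1 + pq.2 = n),
          LinearMap.range (TensorProduct.mapIncl (ℋ pq.1) (ℋ pq.2)))
    (hconn : ℋ 0 = Submodule.span k {(1 : H)}) :
    -- finiteness: if `α(1) = 0` then `α^{*n}` vanishes on `H_m` for `m < n`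
    (∀ f : H →ₗ[k] A, f 1 = 0 → ∀ n m : ℕ, m < n → ∀ x ∈ ℋ m, convPow f n x = 0) ∧
    -- `exp*` maps `g(H,A)` to `G(H,A)` and `log*` recovers the argument
    (∀ f g : H →ₗ[k] A, IsInfChar f →
      (∀ m : ℕ, ∀ x ∈ ℋ m,
        g x = ∑ n ∈ Finset.range (m + 1), ((n.factorial : k))⁻¹ • convPow f n x) →
      IsChar g ∧
      (∀ m : ℕ, ∀ x ∈ ℋ m,
        f x = ∑ n ∈ Finset.Icc 1 m,
          (((-1 : k) ^ (n - 1)) * (n : k)⁻¹) • convPow (g - convUnit k A) n x)) ∧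
    -- `log*` maps `G(H,A)` to `g(H,A)` and `exp*` recovers the argument
    (∀ g f : H →ₗ[k] A, IsChar g →
      (∀ m : ℕ, ∀ x ∈ ℋ m,
        f x = ∑ n ∈ Finset.Icc 1 m,
          (((-1 : k) ^ (n - 1)) * (n : k)⁻¹) • convPow (g - convUnit k A) n x) →
      IsInfChar f ∧
      (∀ m : ℕ, ∀ x ∈ ℋ m,
        g x = ∑ n ∈ Finset.range (m + 1), ((n.factorial : k))⁻¹ • convPow f n x)) := by
  have h1mem : (1 : H) ∈ ℋ 0 := hconn ▸ Submodule.mem_span_singleton_self 1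
  have hvan (f : H →ₗ[k] A) (hf : f 1 = 0) : toConv f ∈ vanishBelow A ℋ 1 := by
    intro j hj x hx
    obtain rfl : j = 0 := by omega
    rw [hconn] at hx
    obtain ⟨c, rfl⟩ := Submodule.mem_span_singleton.mp hx
    change f _ = 0
    simp [hf]
  have hexp (f g : H →ₗ[k] A) (hf : toConv f ∈ vanishBelow A ℋ 1) :
      (∀ n, toConv g - Polynomial.aeval (toConv f) (PowerSeries.trunc n (PowerSeries.exp k)) ∈
        vanishBelow A ℋ n) ↔ ∀ m : ℕ, ∀ x ∈ ℋ m,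
        g x = ∑ n ∈ Finset.range (m + 1), ((n.factorial : k))⁻¹ • convPow f n x := by
    rw [forall_sub_aeval_trunc_mem_iff hcomul hf]
    simp [PowerSeries.coeff_exp, convPow_eq]
  have hlog (f g : H →ₗ[k] A) (hg : toConv g - 1 ∈ vanishBelow A ℋ 1) :
      (∀ n, toConv f - Polynomial.aeval (toConv g - 1) (PowerSeries.trunc n (PowerSeries.log k)) ∈
        vanishBelow A ℋ n) ↔ ∀ m : ℕ, ∀ x ∈ ℋ m, f x = ∑ n ∈ Finset.Icc 1 m,
          (((-1 : k) ^ (n - 1)) * (n : k)⁻¹) • convPow (g - convUnit k A) n x := by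
    rw [forall_sub_aeval_trunc_mem_iff hcomul hg]
    refine forall₃_congr fun m x _ => ?_
    rw [Finset.range_eq_Ico, Finset.sum_eq_sum_Ico_succ_bot m.succ_pos, PowerSeries.coeff_log,
      if_pos rfl, zero_smul, zero_add]
    refine Eq.congr_right (Finset.sum_congr rfl fun n hn => ?_)
    obtain ⟨n, rfl⟩ := Nat.exists_eq_add_of_le' (Finset.mem_Ico.mp hn).1
    rw [convPow_eq]
    simp [pow_succ, div_eq_mul_inv]
    rfl
  refine ⟨fun f hf n m hmn x hx => ?_, fun f g hf h => ?_, fun g f hg h => ?_⟩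
  · rw [convPow_eq]
    exact pow_mem_vanishBelow hcomul (hvan f hf) n m hmn x hx
  · have hf1 : f 1 = 0 := by simpa [convUnit] using hf 1 1
    have hfv := hvan f hf1
    have hg : IsChar g := isChar_of_exp hcomul hmul h1mem hf hfv fun m x hx => by
      simpa only [convPow_eq] using h m x hx
    refine ⟨hg, (hlog f g ?_).mp fun n =>
      sub_aeval_trunc_log_mem hcomul hfv ((hexp f g hfv).mpr h n)⟩
    exact hvan (g - convUnit k A) (by simp [convUnit, hg.1])
  · have hgv : toConv g - 1 ∈ vanishBelow A ℋ 1 :=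
      hvan (g - convUnit k A) (by simp [convUnit, hg.1])
    have hfv : toConv f ∈ vanishBelow A ℋ 1 := hvan f (by simpa using h 0 1 h1mem)
    have hG := fun n => sub_aeval_trunc_exp_mem hcomul hgv ((hlog f g hgv).mpr h n)
    exact ⟨isInfChar_of_exp hcomul hmul hg hfv hG, (hexp f g hfv).mp hG⟩

end
end

section
/- Let H be a commutative, connected, graded Hopf algebra over a field k of characteristic zero. The Eulerian idempotent e = log*(Id) = J − J^{*2}/2 + J^{*3}/3 − ⋯, where J = Id − δ, is an idempotent for composition: e ∘ e = e. -/
open TensorProduct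

noncomputable section

/-- The convolution product on `End_k(H)`: `α * β = μ ∘ (α ⊗ β) ∘ Δ`. -/
def convE {k H : Type} [Field k] [CommRing H] [Bialgebra k H]
    (f g : H →ₗ[k] H) : H →ₗ[k] H :=
  (LinearMap.mul' k H) ∘ₗ (TensorProduct.map f g) ∘ₗ (Coalgebra.comul (R := k))

/-- The convolution unit `δ = η ∘ ε` on `End_k(H)`. -/
def convUnitE (k H : Type) [Field k] [CommRing H] [Bialgebra k H] : H →ₗ[k] H :=
  (Algebra.linearMap k H) ∘ₗ (Coalgebra.counit (R := k))

/-- Convolution powers `f^{*n}`, with `f^{*0} = δ`. -/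
def convEPow {k H : Type} [Field k] [CommRing H] [Bialgebra k H]
    (f : H →ₗ[k] H) : ℕ → (H →ₗ[k] H)
  | 0 => convUnitE k H
  | n + 1 => convE f (convEPow f n)

section Polynomial

open Polynomial

variable {k : Type*} [Field k]

lemma coeff_one_descPochhammer_succ (n : ℕ) :
    (descPochhammer k (n + 1)).coeff 1 = (-1) ^ n * (n.factorial : k) := by
  induction n with
  | zero => simp
  | succ n ih =>
    have h0 : (descPochhammer k (n + 1)).coeff 0 = 0 := by
      rw [coeff_zero_eq_eval_zero, descPochhammer_ne_zero_eval_zero k n.succ_ne_zero]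
    rw [descPochhammer_succ_right, mul_sub, coeff_sub, coeff_mul_X, h0, ← C_eq_natCast,
      coeff_mul_C, ih, Nat.factorial_succ]
    push_cast
    ring

variable (k) in
/-- The polynomial `X (X - 1) ⋯ (X - n + 1) / n!`, whose value at `p : ℕ` is `p.choose n`. -/
def choosePoly (n : ℕ) : k[X] := C (n.factorial : k)⁻¹ * descPochhammer k n

lemma eval_natCast_choosePoly [CharZero k] (n p : ℕ) :
    (choosePoly k n).eval (p : k) = (p.choose n : k) := by
  have h : (n.factorial : k) ≠ 0 := Nat.cast_ne_zero.mpr n.factorial_ne_zero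
  rw [choosePoly, eval_mul, eval_C, descPochhammer_eval_eq_descFactorial,
    Nat.descFactorial_eq_factorial_mul_choose]
  push_cast
  field_simp

lemma natDegree_choosePoly_le (n : ℕ) : (choosePoly k n).natDegree ≤ n :=
  (natDegree_C_mul_le _ _).trans (descPochhammer_natDegree k n).le

lemma coeff_one_choosePoly [CharZero k] (n : ℕ) :
    (choosePoly k n).coeff 1 = (-1) ^ (n + 1) * (n : k)⁻¹ := by
  rw [choosePoly, coeff_C_mul]
  cases n with
  | zero => simp [coeff_one]
  | succ n =>
    have h : (n.factorial : k) ≠ 0 := Nat.cast_ne_zero.mpr n.factorial_ne_zero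
    have h' : ((n : k) + 1) ≠ 0 := Nat.cast_add_one_ne_zero n
    rw [coeff_one_descPochhammer_succ, Nat.factorial_succ]
    push_cast
    field_simp
    ring

variable (k) in
/-- On polynomials of bounded degree, the linear coefficient is a combination of values at
natural numbers. -/
lemma exists_coeff_one_eq_sum_eval [CharZero k] (N : ℕ) :
    ∃ c : ℕ → k, ∀ f : k[X], f.natDegree ≤ N →
      f.coeff 1 = ∑ p ∈ Finset.range (N + 1), c p * f.eval (p : k) := by
  refine ⟨fun p ↦ (Lagrange.basis (Finset.range (N + 1)) (fun i : ℕ ↦ (i : k)) p).coeff 1,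
    fun f hf ↦ ?_⟩
  have hdeg : f.degree < (Finset.range (N + 1)).card := by
    rw [Finset.card_range]
    exact degree_le_natDegree.trans_lt (by exact_mod_cast Nat.lt_succ_of_le hf)
  conv_lhs => rw [Lagrange.eq_interpolate (Nat.cast_injective (R := k)).injOn hdeg,
    Lagrange.interpolate_apply]
  simp [mul_comm]

lemma sum_sum_eval_mul {N : ℕ} {c : ℕ → k}
    (hc : ∀ f : k[X], f.natDegree ≤ N →
      f.coeff 1 = ∑ p ∈ Finset.range (N + 1), c p * f.eval (p : k))
    {f : k[X]} (hf : f.natDegree ≤ N) :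
    ∑ p ∈ Finset.range (N + 1), ∑ q ∈ Finset.range (N + 1), c p * c q * f.eval ((p * q : ℕ) : k) =
      f.coeff 1 := by
  have hlin (a : k) : (C a * X).natDegree ≤ 1 := (natDegree_C_mul_le _ _).trans natDegree_X_le
  have inner (p : ℕ) : ∑ q ∈ Finset.range (N + 1), c q * f.eval ((p * q : ℕ) : k) =
      (C (f.coeff 1) * X).eval (p : k) := by
    have h := hc (f.comp (C (p : k) * X))
      (natDegree_comp_le.trans ((Nat.mul_le_mul hf (hlin _)).trans (by simp)))
    rw [comp_C_mul_X_coeff] at h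
    simpa using h.symm
  by_cases hN : N = 0
  · subst hN
    have hz : f.coeff 1 = 0 := coeff_eq_zero_of_natDegree_lt (by omega)
    simp_rw [mul_assoc, ← Finset.mul_sum, inner, hz]
    simp
  have h := hc (C (f.coeff 1) * X) ((hlin _).trans (Nat.one_le_iff_ne_zero.mpr hN))
  simp_rw [mul_assoc, ← Finset.mul_sum, inner, ← h]
  simp

end Polynomial

section Convolution

open WithConv

variable {k H : Type*} [Field k] [CommRing H] [Bialgebra k H]

/-- The Adams operation `Id^{*p}` as an algebra endomorphism. -/
def adams (k H : Type*) [Field k] [CommRing H] [Bialgebra k H] (p : ℕ) : H →ₐ[k] H :=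
  (toConv (AlgHom.id k H) ^ p).ofConv

lemma comp_convPow (h f : H →ₐ[k] H) (p : ℕ) :
    h.comp (toConv f ^ p).ofConv = (toConv (h.comp f) ^ p).ofConv := by
  induction p with
  | zero =>
    ext x
    simp
  | succ p ih => rw [pow_succ, AlgHom.comp_convMul_distrib, ih, pow_succ]

lemma adams_comp_adams (p q : ℕ) : (adams k H p).comp (adams k H q) = adams k H (p * q) := by
  rw [adams, adams, adams, comp_convPow, AlgHom.comp_id, toConv_ofConv, pow_mul]

/-- The convolution power `J^{*i}` of `J = Id - δ`. -/
def augPow (k H : Type*) [Field k] [CommRing H] [Bialgebra k H] (i : ℕ) : H →ₗ[k] H :=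
  ((toConv (LinearMap.id : H →ₗ[k] H) - 1) ^ i).ofConv

lemma augPow_succ (i : ℕ) : augPow k H (i + 1) =
    LinearMap.mul' k H ∘ₗ TensorProduct.map (augPow k H 1) (augPow k H i) ∘ₗ
      Coalgebra.comul (R := k) := by
  simp only [augPow, pow_succ' _ i, pow_one]
  rfl

lemma augPow_one_one : augPow k H 1 1 = 0 := by
  simp [augPow]

/-- On elements killed by high powers of `J`, the binomial expansion of `(δ + J)^{*p}` has length
independent of `p`. -/
lemma adams_apply_eq_sum {N : ℕ} {x : H} (hx : ∀ i, N < i → augPow k H i x = 0) (p : ℕ) :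
    adams k H p x = ∑ i ∈ Finset.range (N + 1), (p.choose i : k) • augPow k H i x := by
  have h : toConv (adams k H p).toLinearMap =
      ∑ i ∈ Finset.range (p + 1), (p.choose i : k) • toConv (augPow k H i) := by
    rw [adams, AlgHom.toLinearMap_convPow]
    calc _ = ((toConv (LinearMap.id : H →ₗ[k] H) - 1) + 1) ^ p := by rw [sub_add_cancel]; rfl
      _ = _ := by
        rw [(Commute.one_right _).add_pow]
        refine Finset.sum_congr rfl fun i _ ↦ ?_
        rw [one_pow, mul_one, ← nsmul_eq_mul', Nat.cast_smul_eq_nsmul, augPow, toConv_ofConv]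
  have h' : adams k H p x = ∑ i ∈ Finset.range (p + 1), (p.choose i : k) • augPow k H i x := by
    have := congrArg (fun f ↦ f.ofConv x) h
    simpa [ofConv_sum] using this
  rw [h']
  rcases le_total p N with hpN | hpN
  · refine Finset.sum_subset (Finset.range_mono (by omega)) fun i _ hi ↦ ?_
    rw [Nat.choose_eq_zero_of_lt (by simpa using hi), Nat.cast_zero, zero_smul]
  · refine (Finset.sum_subset (Finset.range_mono (by omega)) fun i _ hi ↦ ?_).symm
    rw [hx i (by simpa using hi), smul_zero]

/-- On a connected graded bialgebra, `J^{*i}` vanishes in degrees below `i`. -/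
lemma augPow_eq_zero (ℋ : ℕ → Submodule k H)
    (hcomul : ∀ n : ℕ, ∀ x ∈ ℋ n,
      Coalgebra.comul (R := k) x ∈
        ⨆ (pq : ℕ × ℕ) (_ : pq.1 + pq.2 = n),
          LinearMap.range (TensorProduct.mapIncl (ℋ pq.1) (ℋ pq.2)))
    (hconn : ℋ 0 = Submodule.span k {(1 : H)}) {i n : ℕ} (hi : n < i) {x : H} (hx : x ∈ ℋ n) :
    augPow k H i x = 0 := by
  induction i generalizing n x with
  | zero => omega
  | succ i ih =>
    suffices h : (⨆ (pq : ℕ × ℕ) (_ : pq.1 + pq.2 = n),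
        LinearMap.range (TensorProduct.mapIncl (ℋ pq.1) (ℋ pq.2))) ≤
        LinearMap.ker (TensorProduct.map (augPow k H 1) (augPow k H i)) by
      rw [augPow_succ, LinearMap.comp_apply, LinearMap.comp_apply,
        LinearMap.mem_ker.mp (h (hcomul n x hx)), map_zero]
    refine iSup₂_le ?_
    rintro ⟨p, q⟩ (hpq : p + q = n)
    rw [LinearMap.range_le_ker_iff]
    ext ⟨a, ha⟩ ⟨b, hb⟩
    simp only [TensorProduct.mapIncl, TensorProduct.AlgebraTensorModule.curry_apply,
      LinearMap.restrictScalars_self, TensorProduct.curry_apply, LinearMap.comp_apply,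
      TensorProduct.map_tmul, Submodule.subtype_apply, LinearMap.zero_apply]
    rcases Nat.eq_zero_or_pos p with rfl | hp
    · rw [hconn, Submodule.mem_span_singleton] at ha
      obtain ⟨r, rfl⟩ := ha
      rw [map_smul, augPow_one_one, smul_zero, TensorProduct.zero_tmul]
    · rw [ih (by omega) hb, TensorProduct.tmul_zero]

end Convolution

lemma convEPow_eq_augPow {k H : Type} [Field k] [CommRing H] [Bialgebra k H] (i : ℕ) :
    convEPow (LinearMap.id - convUnitE k H) i = augPow k H i := by
  induction i with
  | zero => rfl
  | succ i ih =>
    rw [convEPow, ih, augPow_succ, augPow.eq_def k H 1, pow_one]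
    rfl

/-- For a commutative, connected, graded Hopf algebra `H` over a field `k`
of characteristic zero, the Eulerian idempotent `e = log*(Id) = ∑_{i≥1} (-1)^{i+1} J^{*i}/i`
(`J = Id - δ`), whose value on the graded piece `H_n` is the finite sum
`∑_{i=1}^{n} (-1)^{i+1} J^{*i}/i`, is idempotent for composition: `e ∘ e = e`. -/
theorem eulerian_idempotent_is_idempotent
    {k H : Type} [Field k] [CharZero k] [CommRing H] [HopfAlgebra k H]
    (ℋ : ℕ → Submodule k H) [DirectSum.Decomposition ℋ]
    (hmul : ∀ p q : ℕ, ∀ x ∈ ℋ p, ∀ y ∈ ℋ q, x * y ∈ ℋ (p + q))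
    (hcomul : ∀ n : ℕ, ∀ x ∈ ℋ n,
      Coalgebra.comul (R := k) x ∈
        ⨆ (pq : ℕ × ℕ) (_ : pq.1 + pq.2 = n),
          LinearMap.range (TensorProduct.mapIncl (ℋ pq.1) (ℋ pq.2)))
    (hconn : ℋ 0 = Submodule.span k {(1 : H)})
    (e : H →ₗ[k] H)
    (he : ∀ n : ℕ, ∀ x ∈ ℋ n,
      e x = ∑ i ∈ Finset.Icc 1 n,
        (((-1 : k) ^ (i + 1)) * (i : k)⁻¹) •
          convEPow (LinearMap.id - convUnitE k H) i x) :
    e ∘ₗ e = e := by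
  have hlocal (x : H) : ∃ N, ∀ M, N ≤ M → (∀ i, M < i → augPow k H i x = 0) ∧
      e x = ∑ i ∈ Finset.range (M + 1), (choosePoly k i).coeff 1 • augPow k H i x := by
    induction x using DirectSum.Decomposition.inductionOn ℋ with
    | zero => exact ⟨0, by simp⟩
    | @homogeneous n x =>
      have hz {i : ℕ} (hi : n < i) : augPow k H i (x : H) = 0 :=
        augPow_eq_zero ℋ hcomul hconn hi x.2
      refine ⟨n, fun M hM ↦ ⟨fun i hi ↦ hz (hM.trans_lt hi), ?_⟩⟩
      simp_rw [he n x x.2, convEPow_eq_augPow, coeff_one_choosePoly]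
      refine Finset.sum_subset (fun i hi ↦ ?_) fun i _ hi ↦ ?_
      · simp only [Finset.mem_Icc, Finset.mem_range] at hi ⊢
        omega
      · rcases Nat.eq_zero_or_pos i with rfl | hpos
        · simp
        · rw [hz (by simp only [Finset.mem_Icc] at hi; omega), smul_zero]
    | add x y hx hy =>
      obtain ⟨N, hN⟩ := hx
      obtain ⟨N', hN'⟩ := hy
      refine ⟨max N N', fun M hM ↦ ?_⟩
      obtain ⟨hx, hex⟩ := hN M (le_of_max_le_left hM)
      obtain ⟨hy, hey⟩ := hN' M (le_of_max_le_right hM)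
      exact ⟨fun i hi ↦ by rw [map_add, hx i hi, hy i hi, add_zero],
        by simp_rw [map_add, hex, hey, smul_add, Finset.sum_add_distrib]⟩
  ext x
  obtain ⟨N₁, hN₁⟩ := hlocal x
  obtain ⟨N₂, hN₂⟩ := hlocal (e x)
  obtain ⟨N, h₁, h₂⟩ : ∃ N, N₁ ≤ N ∧ N₂ ≤ N := ⟨_, le_max_left _ _, le_max_right _ _⟩
  obtain ⟨hx, hex⟩ := hN₁ N h₁
  obtain ⟨hy, hey⟩ := hN₂ N h₂
  obtain ⟨c, hc⟩ := exists_coeff_one_eq_sum_eval k N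
  have hdeg {i : ℕ} (hi : i ∈ Finset.range (N + 1)) : (choosePoly k i).natDegree ≤ N :=
    (natDegree_choosePoly_le i).trans (Nat.lt_succ_iff.mp (Finset.mem_range.mp hi))
  have key {y : H} (hy : ∀ i, N < i → augPow k H i y = 0)
      (hey : e y = ∑ i ∈ Finset.range (N + 1), (choosePoly k i).coeff 1 • augPow k H i y) :
      e y = ∑ p ∈ Finset.range (N + 1), c p • adams k H p y := by
    simp_rw [adams_apply_eq_sum hy, Finset.smul_sum, smul_smul]
    rw [Finset.sum_comm, hey]
    refine Finset.sum_congr rfl fun i hi ↦ ?_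
    simp_rw [hc _ (hdeg hi), eval_natCast_choosePoly, Finset.sum_smul]
  have hcomp (p q : ℕ) : adams k H p (adams k H q x) = adams k H (p * q) x :=
    DFunLike.congr_fun (adams_comp_adams p q) x
  calc e (e x)
      = ∑ p ∈ Finset.range (N + 1), ∑ q ∈ Finset.range (N + 1), (c p * c q) •
          adams k H (p * q) x := by
        rw [key hy hey, key hx hex]
        simp_rw [map_sum, map_smul, hcomp, Finset.smul_sum, smul_smul]
    _ = ∑ i ∈ Finset.range (N + 1), (∑ p ∈ Finset.range (N + 1), ∑ q ∈ Finset.range (N + 1),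
          c p * c q * (choosePoly k i).eval ((p * q : ℕ) : k)) • augPow k H i x := by
        simp_rw [adams_apply_eq_sum hx, eval_natCast_choosePoly, Finset.sum_smul, Finset.smul_sum,
          smul_smul]
        refine Eq.trans ?_ Finset.sum_comm
        exact Finset.sum_congr rfl fun p _ ↦ Finset.sum_comm
    _ = e x := by
        rw [hex]
        exact Finset.sum_congr rfl fun i hi ↦ by rw [sum_sum_eval_mul hc (hdeg hi)]

end
end

section
/- Let H be a graded, commutative, connected Hopf algebra over a field k of characteristic zero, with grading operator Y (acting on H_n as multiplication by n) and antipode S. Then the Dynkin operator D = S * Y (convolution product of S and Y in End_k(H)) is an H-valued infinitesimal character of H: D(xy) = D(x)u(y) + u(x)D(y) for all x,y ∈ H, where u = η ∘ ε. -/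
open TensorProduct

noncomputable section

/-- The map `u = η ∘ ε`. -/
def unitCounit (k H : Type) [Field k] [CommRing H] [Bialgebra k H] : H →ₗ[k] H :=
  (Algebra.linearMap k H) ∘ₗ (Coalgebra.counit (R := k))

/-- An operator acting on each graded piece as multiplication by its degree is a derivation. -/
theorem leibniz_of_degree_smul {k H : Type} [Field k] [CommRing H] [Algebra k H]
    (ℋ : ℕ → Submodule k H) [DirectSum.Decomposition ℋ]
    (hmul : ∀ p q : ℕ, ∀ x ∈ ℋ p, ∀ y ∈ ℋ q, x * y ∈ ℋ (p + q))
    (Y : H →ₗ[k] H) (hY : ∀ n : ℕ, ∀ x ∈ ℋ n, Y x = (n : k) • x) (x y : H) :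
    Y (x * y) = Y x * y + x * Y y := by
  induction x using DirectSum.Decomposition.inductionOn ℋ with
  | zero => simp
  | add a b ha hb => simp only [add_mul, map_add, ha, hb]; ring
  | @homogeneous p a =>
    induction y using DirectSum.Decomposition.inductionOn ℋ with
    | zero => simp
    | add c d hc hd => simp only [mul_add, map_add, hc, hd]; ring
    | @homogeneous q b =>
      rw [hY _ _ (hmul p q a a.2 b b.2), hY p a a.2, hY q b b.2, smul_mul_assoc,
        mul_smul_comm, ← add_smul, Nat.cast_add]

/-- Twisting the multiplication of `H` by a multiplicative map on the left factor and a derivation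
on the right factor gives a derivation of `H ⊗ H` along the twist by the identity. -/
theorem mul'_map_mul_of_leibniz {k H : Type} [Field k] [CommRing H] [Algebra k H]
    (S Y : H →ₗ[k] H) (hS : ∀ x y, S (x * y) = S x * S y)
    (hY : ∀ x y, Y (x * y) = Y x * y + x * Y y) (a b : H ⊗[k] H) :
    LinearMap.mul' k H (TensorProduct.map S Y (a * b)) =
      LinearMap.mul' k H (TensorProduct.map S Y a) * LinearMap.mul' k H (S.rTensor H b) +
        LinearMap.mul' k H (S.rTensor H a) * LinearMap.mul' k H (TensorProduct.map S Y b) := by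
  induction a using TensorProduct.induction_on with
  | zero => simp
  | add a c ha hc => simp only [add_mul, map_add, ha, hc]; ring
  | tmul x x' =>
    induction b using TensorProduct.induction_on with
    | zero => simp
    | add b d hb hd => simp only [mul_add, map_add, hb, hd]; ring
    | tmul y y' =>
      simp only [Algebra.TensorProduct.tmul_mul_tmul, TensorProduct.map_tmul,
        LinearMap.rTensor_tmul, LinearMap.mul'_apply, hS, hY]
      ring

/-- Let `H` be a graded, commutative, connected Hopf algebra over a field
`k` of characteristic zero, with grading operator `Y` (acting on `H_n` as multiplication
by `n`) and antipode `S`.  Then the Dynkin operator `D = S * Y` is an `H`-valued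
infinitesimal character: `D(xy) = D(x)u(y) + u(x)D(y)` for all `x, y ∈ H`, where
`u = η ∘ ε`. -/
theorem dynkin_operator_is_infinitesimal_character
    {k H : Type} [Field k] [CharZero k] [CommRing H] [HopfAlgebra k H]
    (ℋ : ℕ → Submodule k H) [DirectSum.Decomposition ℋ]
    (hmul : ∀ p q : ℕ, ∀ x ∈ ℋ p, ∀ y ∈ ℋ q, x * y ∈ ℋ (p + q))
    (hcomul : ∀ n : ℕ, ∀ x ∈ ℋ n,
      Coalgebra.comul (R := k) x ∈
        ⨆ (pq : ℕ × ℕ) (_ : pq.1 + pq.2 = n),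
          LinearMap.range (TensorProduct.mapIncl (ℋ pq.1) (ℋ pq.2)))
    (hconn : ℋ 0 = Submodule.span k {(1 : H)})
    -- the grading operator `Y`
    (Y : H →ₗ[k] H) (hY : ∀ n : ℕ, ∀ x ∈ ℋ n, Y x = (n : k) • x) :
    ∀ x y : H,
      convE (HopfAlgebra.antipode (R := k)) Y (x * y) =
        convE (HopfAlgebra.antipode (R := k)) Y x * unitCounit k H y
          + unitCounit k H x * convE (HopfAlgebra.antipode (R := k)) Y y := by
  intro x y
  simp only [convE, unitCounit, LinearMap.comp_apply, Bialgebra.comul_mul,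
    Algebra.linearMap_apply]
  rw [mul'_map_mul_of_leibniz _ _
    (fun a b => (HopfAlgebra.antipode_mul_antidistrib a b).trans (mul_comm _ _))
    (leibniz_of_degree_smul ℋ hmul Y hY)]
  simp only [HopfAlgebra.mul_antipode_rTensor_comul_apply]

end
end

section
/- In the free associative ℚ-algebra on two noncommuting generators x and ∂, define B_0 = 1 and B_n = x·B_{n−1} + ∂·B_{n−1} − B_{n−1}·∂ for n ≥ 1 (the noncommutative Bell polynomials, with d_1 = x and d_i = [∂, d_{i−1}]). Then for every n ≥ 0 the binomial relation (x + ∂)^n = Σ_{k=0}^{n} C(n,k) · B_k · ∂^{n−k} holds, where C(n,k) is the binomial coefficient. -/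
noncomputable section

/-- The free associative `ℚ`-algebra on two noncommuting generators `x` and `∂`. -/
abbrev A2 : Type := FreeAlgebra ℚ (Fin 2)

/-- The generator `x` (that is, `d₁`). -/
def xGen : A2 := FreeAlgebra.ι ℚ 0

/-- The generator `∂`. -/
def pGen : A2 := FreeAlgebra.ι ℚ 1

/-- The noncommutative Bell polynomials: `B₀ = 1`, `Bₙ = x·B_{n-1} + [∂, B_{n-1}]`. -/
def Bell : ℕ → A2
  | 0 => 1
  | n + 1 => xGen * Bell n + pGen * Bell n - Bell n * pGen

theorem add_mul_Bell_mul_pow (k m : ℕ) :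
    (xGen + pGen) * (Bell k * pGen ^ m) = Bell k * pGen ^ (m + 1) + Bell (k + 1) * pGen ^ m := by
  rw [Bell, pow_succ']
  noncomm_ring

theorem add_pow_eq_sum_antidiagonal (n : ℕ) :
    (xGen + pGen) ^ n =
      ∑ ij ∈ Finset.HasAntidiagonal.antidiagonal n, n.choose ij.1 • (Bell ij.1 * pGen ^ ij.2) := by
  induction n with
  | zero => simp [Bell]
  | succ n ih =>
    rw [Finset.sum_antidiagonal_choose_succ_nsmul fun i j => Bell i * pGen ^ j,
      pow_succ', ih, Finset.mul_sum, ← Finset.sum_add_distrib]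
    refine Finset.sum_congr rfl fun ij hij => ?_
    rw [mul_smul_comm, add_mul_Bell_mul_pow, smul_add,
      Nat.choose_symm_of_eq_add (Finset.HasAntidiagonal.mem_antidiagonal.mp hij).symm]

/-- In the free associative `ℚ`-algebra on two noncommuting generators
`x` and `∂`, with the noncommutative Bell polynomials `B₀ = 1`,
`Bₙ = x·B_{n-1} + ∂·B_{n-1} - B_{n-1}·∂`, the binomial relation
`(x + ∂)ⁿ = ∑_{k=0}^{n} C(n,k) · B_k · ∂^{n-k}` holds for every `n ≥ 0`. -/
theorem bell_binomial_relation (n : ℕ) :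
    (xGen + pGen) ^ n =
      ∑ k ∈ Finset.range (n + 1), (n.choose k : A2) * (Bell k * pGen ^ (n - k)) := by
  rw [add_pow_eq_sum_antidiagonal, Finset.Nat.sum_antidiagonal_eq_sum_range_succ_mk]
  simp only [nsmul_eq_mul]

end
end

section
/- In the free associative ℚ-algebra on two noncommuting generators x and ∂, define d_1 = x, d_{i+1} = [∂, d_i], and the noncommutative Bell polynomials by B_0 = 1, B_n = x·B_{n−1} + ∂·B_{n−1} − B_{n−1}·∂. Then for every n ≥ 0 the recursion B_{n+1} = Σ_{k=0}^{n} C(n,k) · B_k · d_{n−k+1} holds, where C(n,k) is the binomial coefficient. -/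
noncomputable section

/-- `dGen i = d_{i+1}`, where `d₁ = x` and `d_{i+1} = [∂, d_i]`. -/
def dGen : ℕ → A2
  | 0 => xGen
  | i + 1 => pGen * dGen i - dGen i * pGen

theorem Bell_succ_mul_dGen_add (k j : ℕ) :
    Bell (k + 1) * dGen j + Bell k * dGen (j + 1) =
      xGen * (Bell k * dGen j) + pGen * (Bell k * dGen j) - Bell k * dGen j * pGen := by
  simp only [Bell, dGen]
  noncomm_ring

theorem Bell_succ_eq_sum_antidiagonal (n : ℕ) :
    Bell (n + 1) =
      ∑ ij ∈ Finset.HasAntidiagonal.antidiagonal n, n.choose ij.1 • (Bell ij.1 * dGen ij.2) := by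
  induction n with
  | zero => simp [Bell, dGen]
  | succ n ih =>
    rw [Finset.sum_antidiagonal_choose_succ_nsmul (fun i j => Bell i * dGen j), Bell, ih,
      Finset.mul_sum, Finset.mul_sum, Finset.sum_mul, ← Finset.sum_add_distrib,
      ← Finset.sum_sub_distrib, ← Finset.sum_add_distrib]
    refine Finset.sum_congr rfl fun ij hij => ?_
    rw [← Nat.choose_symm_of_eq_add (Finset.HasAntidiagonal.mem_antidiagonal.mp hij).symm, ← smul_add,
      add_comm (Bell ij.1 * _), Bell_succ_mul_dGen_add, mul_smul_comm, mul_smul_comm,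
      smul_mul_assoc, ← smul_add, ← smul_sub]

/-- With `d₁ = x`, `d_{i+1} = [∂, d_i]` and the noncommutative Bell
polynomials `B₀ = 1`, `Bₙ = x·B_{n-1} + ∂·B_{n-1} - B_{n-1}·∂`, the recursion
`B_{n+1} = ∑_{k=0}^{n} C(n,k) · B_k · d_{n-k+1}` holds for every `n ≥ 0`. -/
theorem bell_recursion (n : ℕ) :
    Bell (n + 1) =
      ∑ k ∈ Finset.range (n + 1), (n.choose k : A2) * (Bell k * dGen (n - k)) := by
  rw [Bell_succ_eq_sum_antidiagonal, Finset.Nat.sum_antidiagonal_eq_sum_range_succ_mk]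
  simp only [nsmul_eq_mul]

end
end

section
/- Let A be an alphabet and ℝ⟨A⟩ the free ℝ-vector space on the words over A, equipped with the shuffle product ⧢ (defined recursively by 1⧢ω = ω⧢1 = ω and (aω)⧢(bω′) = a(ω⧢bω′) + b(aω⧢ω′) for letters a,b and words ω,ω′), the deconcatenation coproduct Δ(a_1⋯a_k) = Σ_{i=0}^{k} a_1⋯a_i ⊗ a_{i+1}⋯a_k, unit the empty word 1, and counit ε(1)=1, ε(ω)=0 for nonempty ω. Then this data forms a Hopf algebra (the shuffle Hopf algebra), and its antipode is given by signed reversal: S(a_1 a_2 ⋯ a_k) = (−1)^k a_k a_{k−1} ⋯ a_1. -/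
open TensorProduct

noncomputable section

variable {α : Type}

/-- The free `ℝ`-vector space `ℝ⟨A⟩` on the words over the alphabet `α`. -/
abbrev ShAlg (α : Type) : Type := List α →₀ ℝ

/-- Prepending a letter to every word, extended linearly. -/
def prep (a : α) : ShAlg α →ₗ[ℝ] ShAlg α :=
  Finsupp.lmapDomain ℝ ℝ (fun w => a :: w)

/-- The shuffle of two words:  `1 ⧢ ω = ω ⧢ 1 = ω` and
`(aω) ⧢ (bω') = a(ω ⧢ bω') + b(aω ⧢ ω')`. -/
def wsh : List α → List α → ShAlg α
  | [], w => Finsupp.single w 1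
  | w, [] => Finsupp.single w 1
  | a :: u, b :: v => prep a (wsh u (b :: v)) + prep b (wsh (a :: u) v)
  termination_by w₁ w₂ => w₁.length + w₂.length
  decreasing_by
    all_goals simp [List.length_cons]

/-- The shuffle product `⧢` on `ℝ⟨A⟩`, as a bilinear map. -/
def shL : ShAlg α →ₗ[ℝ] ShAlg α →ₗ[ℝ] ShAlg α :=
  Finsupp.lsum ℝ fun w =>
    LinearMap.toSpanSingleton ℝ (ShAlg α →ₗ[ℝ] ShAlg α)
      (Finsupp.lsum ℝ fun w' => LinearMap.toSpanSingleton ℝ (ShAlg α) (wsh w w'))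

/-- Deconcatenation of a word: `Δ(a₁⋯a_k) = ∑_{i=0}^{k} a₁⋯a_i ⊗ a_{i+1}⋯a_k`. -/
def deconcatWord (w : List α) : ShAlg α ⊗[ℝ] ShAlg α :=
  ∑ i ∈ Finset.range (w.length + 1),
    Finsupp.single (w.take i) (1 : ℝ) ⊗ₜ[ℝ] Finsupp.single (w.drop i) (1 : ℝ)

/-- The deconcatenation coproduct, extended linearly. -/
def deconcat : ShAlg α →ₗ[ℝ] ShAlg α ⊗[ℝ] ShAlg α :=
  Finsupp.lsum ℝ fun w =>
    LinearMap.toSpanSingleton ℝ (ShAlg α ⊗[ℝ] ShAlg α) (deconcatWord w)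

/-- The counit: `ε(1) = 1`, `ε(ω) = 0` for nonempty `ω` (the coefficient of the
empty word). -/
def counitSh : ShAlg α →ₗ[ℝ] ℝ := Finsupp.lapply ([] : List α)

/-- The shuffle product as a map `ℝ⟨A⟩ ⊗ ℝ⟨A⟩ → ℝ⟨A⟩`. -/
def msh : ShAlg α ⊗[ℝ] ShAlg α →ₗ[ℝ] ShAlg α := TensorProduct.lift shL

/-- The componentwise shuffle product on `ℝ⟨A⟩ ⊗ ℝ⟨A⟩`:
`(a ⊗ b)·(c ⊗ d) = (a ⧢ c) ⊗ (b ⧢ d)`. -/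
def mshT (x y : ShAlg α ⊗[ℝ] ShAlg α) : ShAlg α ⊗[ℝ] ShAlg α :=
  (TensorProduct.map msh msh)
    ((TensorProduct.tensorTensorTensorComm ℝ (ShAlg α) (ShAlg α) (ShAlg α) (ShAlg α))
      (x ⊗ₜ[ℝ] y))

/-- Linear induction on `ℝ⟨A⟩`: it suffices to treat words, sums and scalar multiples. -/
theorem ShAlg.induction {p : ShAlg α → Prop} (word : ∀ w, p (Finsupp.single w 1))
    (add : ∀ x y, p x → p y → p (x + y)) (smul : ∀ (r : ℝ) x, p x → p (r • x)) (x : ShAlg α) :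
    p x := by
  induction x using Finsupp.induction_linear with
  | zero => simpa using smul 0 _ (word [])
  | add f g hf hg => exact add f g hf hg
  | single w r => simpa using smul r _ (word w)

/-- Linear induction on `ℝ⟨A⟩`, with words built letter by letter. -/
theorem ShAlg.induction_prep {p : ShAlg α → Prop} (nil : p (Finsupp.single [] 1))
    (prep : ∀ a x, p x → p (prep a x))
    (add : ∀ x y, p x → p y → p (x + y)) (smul : ∀ (r : ℝ) x, p x → p (r • x)) (x : ShAlg α) :
    p x := by
  refine ShAlg.induction (fun w => ?_) add smul x
  induction w with
  | nil => exact nil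
  | cons a w ih => simpa [_root_.prep] using prep a _ ih

@[simp]
theorem prep_single (a : α) (w : List α) (r : ℝ) :
    prep a (Finsupp.single w r) = Finsupp.single (a :: w) r := by
  simp [prep]

@[simp]
theorem wsh_nil_left (w : List α) : wsh [] w = Finsupp.single w 1 := by
  rw [wsh]

@[simp]
theorem wsh_nil_right (w : List α) : wsh w [] = Finsupp.single w 1 := by
  cases w <;> simp [wsh]

theorem wsh_cons_cons (a b : α) (u v : List α) :
    wsh (a :: u) (b :: v) = prep a (wsh u (b :: v)) + prep b (wsh (a :: u) v) := by
  rw [wsh]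

@[simp]
theorem shL_single (u v : List α) :
    shL (Finsupp.single u 1) (Finsupp.single v 1) = wsh u v := by
  simp [shL]

@[simp]
theorem msh_tmul (x y : ShAlg α) : msh (x ⊗ₜ[ℝ] y) = shL x y := rfl

theorem one_shL (x : ShAlg α) : shL (Finsupp.single [] 1) x = x := by
  induction x using ShAlg.induction <;> simp_all

theorem shL_one (x : ShAlg α) : shL x (Finsupp.single [] 1) = x := by
  induction x using ShAlg.induction <;> simp_all

theorem shL_prep_prep (a b : α) (x y : ShAlg α) :
    shL (prep a x) (prep b y) = prep a (shL x (prep b y)) + prep b (shL (prep a x) y) := by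
  induction x using ShAlg.induction with
  | word u =>
    induction y using ShAlg.induction with
    | word v => simp [wsh_cons_cons]
    | add y y' h h' => simp only [map_add, h, h']; abel
    | smul r y h => simp only [map_smul, h, smul_add]
  | add x x' h h' => simp only [map_add, LinearMap.add_apply, h, h']; abel
  | smul r x h => simp only [map_smul, LinearMap.smul_apply, h, smul_add]

theorem shL_assoc (x y z : ShAlg α) : shL (shL x y) z = shL x (shL y z) := by
  induction x using ShAlg.induction_prep generalizing y z with
  | nil => simp only [one_shL]
  | prep a x hx =>
    induction y using ShAlg.induction_prep generalizing z with
    | nil => simp only [one_shL, shL_one]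
    | prep b y hy =>
      induction z using ShAlg.induction_prep with
      | nil => simp only [shL_one]
      | prep c z hz =>
        rw [shL_prep_prep b c, map_add, shL_prep_prep a b, shL_prep_prep a c, ← hz,
          shL_prep_prep a b, map_add shL, LinearMap.add_apply, shL_prep_prep a c,
          shL_prep_prep b c, hx, hy, shL_prep_prep b c, shL_prep_prep a b x y]
        simp only [map_add, LinearMap.add_apply]
        abel
      | add z z' h h' => simp only [map_add, h, h']
      | smul r z h => simp only [map_smul, h]
    | add y y' h h' => simp only [map_add, LinearMap.add_apply, h, h']
    | smul r y h => simp only [map_smul, LinearMap.smul_apply, h]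
  | add x x' h h' => simp only [map_add, LinearMap.add_apply, h, h']
  | smul r x h => simp only [map_smul, LinearMap.smul_apply, h]

theorem shL_comm (x y : ShAlg α) : shL x y = shL y x := by
  induction x using ShAlg.induction_prep generalizing y with
  | nil => simp only [one_shL, shL_one]
  | prep a x hx =>
    induction y using ShAlg.induction_prep with
    | nil => simp only [one_shL, shL_one]
    | prep b y hy => rw [shL_prep_prep, shL_prep_prep, hx, hy, add_comm]
    | add y y' h h' => simp only [map_add, LinearMap.add_apply, h, h']
    | smul r y h => simp only [map_smul, LinearMap.smul_apply, h]
  | add x x' h h' => simp only [map_add, LinearMap.add_apply, h, h']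
  | smul r x h => simp only [map_smul, LinearMap.smul_apply, h]

theorem deconcat_single (w : List α) : deconcat (Finsupp.single w 1) = deconcatWord w := by
  simp [deconcat]

theorem deconcat_one :
    deconcat (Finsupp.single ([] : List α) (1 : ℝ)) =
      Finsupp.single [] 1 ⊗ₜ[ℝ] Finsupp.single [] 1 := by
  simp [deconcat_single, deconcatWord]

theorem deconcat_prep (a : α) (x : ShAlg α) :
    deconcat (prep a x) =
      Finsupp.single [] 1 ⊗ₜ[ℝ] prep a x +
        TensorProduct.map (prep a) LinearMap.id (deconcat x) := by
  induction x using ShAlg.induction with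
  | word w =>
    rw [prep_single, deconcat_single, deconcat_single, deconcatWord, deconcatWord,
      List.length_cons, Finset.sum_range_succ', add_comm]
    simp
  | add x y hx hy => simp only [map_add, hx, hy, tmul_add]; abel
  | smul r x h => simp only [map_smul, h, tmul_smul, smul_add]

@[simp]
theorem counitSh_one : counitSh (Finsupp.single ([] : List α) (1 : ℝ)) = 1 := by
  simp [counitSh]

@[simp]
theorem counitSh_prep (a : α) (x : ShAlg α) : counitSh (prep a x) = 0 := by
  induction x using ShAlg.induction with
  | word w => simp [counitSh]
  | add x y hx hy => simp only [map_add, hx, hy, add_zero]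
  | smul r x h => simp only [map_smul, h, smul_zero]

theorem deconcat_coassoc (x : ShAlg α) :
    (TensorProduct.assoc ℝ (ShAlg α) (ShAlg α) (ShAlg α))
        ((TensorProduct.map deconcat LinearMap.id) (deconcat x)) =
      (TensorProduct.map LinearMap.id deconcat) (deconcat x) := by
  induction x using ShAlg.induction_prep with
  | nil => simp only [deconcat_one, map_tmul, LinearMap.id_apply, assoc_tmul]
  | prep a x hx =>
    have key (t : ShAlg α ⊗[ℝ] ShAlg α) :
        (TensorProduct.assoc ℝ (ShAlg α) (ShAlg α) (ShAlg α))
            (TensorProduct.map deconcat LinearMap.id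
              (TensorProduct.map (prep a) LinearMap.id t)) =
          Finsupp.single [] 1 ⊗ₜ[ℝ] TensorProduct.map (prep a) LinearMap.id t +
            TensorProduct.map (prep a) LinearMap.id
              ((TensorProduct.assoc ℝ (ShAlg α) (ShAlg α) (ShAlg α))
                (TensorProduct.map deconcat LinearMap.id t)) := by
      induction t using TensorProduct.induction_on with
      | zero => simp
      | add s t hs ht => simp only [map_add, hs, ht, tmul_add]; abel
      | tmul y z =>
        simp only [map_tmul, LinearMap.id_apply, deconcat_prep, add_tmul, map_add, assoc_tmul]
        congr 1
        induction deconcat y using TensorProduct.induction_on with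
        | zero => simp
        | add s t hs ht => simp only [map_add, add_tmul, hs, ht]
        | tmul u v => simp
    have key' (t : ShAlg α ⊗[ℝ] ShAlg α) :
        TensorProduct.map LinearMap.id deconcat (TensorProduct.map (prep a) LinearMap.id t) =
          TensorProduct.map (prep a) LinearMap.id
            (TensorProduct.map LinearMap.id deconcat t) := by
      simp only [TensorProduct.map_map, LinearMap.id_comp, LinearMap.comp_id]
    rw [deconcat_prep]
    simp only [map_add, key, key', hx, map_tmul, LinearMap.id_apply, deconcat_one, assoc_tmul,
      deconcat_prep, tmul_add]
    abel
  | add x y hx hy => simp only [map_add, hx, hy]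
  | smul r x h => simp only [map_smul, h]

theorem lid_map_counitSh_deconcat (x : ShAlg α) :
    (TensorProduct.lid ℝ (ShAlg α))
      ((TensorProduct.map counitSh LinearMap.id) (deconcat x)) = x := by
  induction x using ShAlg.induction_prep with
  | nil => simp [deconcat_one]
  | prep a x hx =>
    have h : counitSh ∘ₗ prep a = 0 := LinearMap.ext (counitSh_prep a)
    rw [deconcat_prep, map_add, TensorProduct.map_map, h]
    simp
  | add x y hx hy => simp only [map_add, hx, hy]
  | smul r x h => simp only [map_smul, h]

theorem rid_map_counitSh_deconcat (x : ShAlg α) :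
    (TensorProduct.rid ℝ (ShAlg α))
      ((TensorProduct.map LinearMap.id counitSh) (deconcat x)) = x := by
  induction x using ShAlg.induction_prep with
  | nil => simp [deconcat_one]
  | prep a x hx =>
    have key (t : ShAlg α ⊗[ℝ] ShAlg α) :
        (TensorProduct.rid ℝ (ShAlg α)) (TensorProduct.map LinearMap.id counitSh
            (TensorProduct.map (prep a) LinearMap.id t)) =
          prep a ((TensorProduct.rid ℝ (ShAlg α))
            (TensorProduct.map LinearMap.id counitSh t)) := by
      induction t using TensorProduct.induction_on with
      | zero => simp
      | add s t hs ht => simp only [map_add, hs, ht]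
      | tmul y z => simp only [map_tmul, LinearMap.id_apply, rid_tmul, map_smul]
    rw [deconcat_prep, map_add, map_add, key, hx]
    simp
  | add x y hx hy => simp only [map_add, hx, hy]
  | smul r x h => simp only [map_smul, h]

@[simp]
theorem mshT_tmul (a b c d : ShAlg α) :
    mshT (a ⊗ₜ[ℝ] b) (c ⊗ₜ[ℝ] d) = shL a c ⊗ₜ[ℝ] shL b d := rfl

theorem mshT_add_left (s s' t : ShAlg α ⊗[ℝ] ShAlg α) :
    mshT (s + s') t = mshT s t + mshT s' t := by
  simp only [mshT, add_tmul, map_add]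

theorem mshT_add_right (s t t' : ShAlg α ⊗[ℝ] ShAlg α) :
    mshT s (t + t') = mshT s t + mshT s t' := by
  simp only [mshT, tmul_add, map_add]

theorem mshT_smul_left (r : ℝ) (s t : ShAlg α ⊗[ℝ] ShAlg α) :
    mshT (r • s) t = r • mshT s t := by
  simp only [mshT, ← smul_tmul', map_smul]

theorem mshT_smul_right (r : ℝ) (s t : ShAlg α ⊗[ℝ] ShAlg α) :
    mshT s (r • t) = r • mshT s t := by
  simp only [mshT, tmul_smul, map_smul]

@[simp]
theorem mshT_zero_left (t : ShAlg α ⊗[ℝ] ShAlg α) : mshT 0 t = 0 := by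
  simp [mshT]

@[simp]
theorem mshT_zero_right (s : ShAlg α ⊗[ℝ] ShAlg α) : mshT s 0 = 0 := by
  simp [mshT]

theorem mshT_one_left (t : ShAlg α ⊗[ℝ] ShAlg α) :
    mshT (Finsupp.single [] 1 ⊗ₜ[ℝ] Finsupp.single [] 1) t = t := by
  induction t using TensorProduct.induction_on with
  | zero => simp
  | add s t hs ht => rw [mshT_add_right, hs, ht]
  | tmul y z => rw [mshT_tmul, one_shL, one_shL]

theorem mshT_one_right (t : ShAlg α ⊗[ℝ] ShAlg α) :
    mshT t (Finsupp.single [] 1 ⊗ₜ[ℝ] Finsupp.single [] 1) = t := by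
  induction t using TensorProduct.induction_on with
  | zero => simp
  | add s t hs ht => rw [mshT_add_left, hs, ht]
  | tmul y z => rw [mshT_tmul, shL_one, shL_one]

theorem mshT_map_prep_one_tmul (a : α) (t : ShAlg α ⊗[ℝ] ShAlg α) (z : ShAlg α) :
    mshT (TensorProduct.map (prep a) LinearMap.id t) (Finsupp.single [] 1 ⊗ₜ[ℝ] z) =
      TensorProduct.map (prep a) LinearMap.id (mshT t (Finsupp.single [] 1 ⊗ₜ[ℝ] z)) := by
  induction t using TensorProduct.induction_on with
  | zero => simp
  | add s t hs ht => simp only [map_add, mshT_add_left, hs, ht]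
  | tmul x y => simp only [map_tmul, mshT_tmul, shL_one, LinearMap.id_apply]

theorem mshT_one_tmul_map_prep (a : α) (t : ShAlg α ⊗[ℝ] ShAlg α) (z : ShAlg α) :
    mshT (Finsupp.single [] 1 ⊗ₜ[ℝ] z) (TensorProduct.map (prep a) LinearMap.id t) =
      TensorProduct.map (prep a) LinearMap.id (mshT (Finsupp.single [] 1 ⊗ₜ[ℝ] z) t) := by
  induction t using TensorProduct.induction_on with
  | zero => simp
  | add s t hs ht => simp only [map_add, mshT_add_right, hs, ht]
  | tmul x y => simp only [map_tmul, mshT_tmul, one_shL, LinearMap.id_apply]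

theorem mshT_map_prep_map_prep (a b : α) (s t : ShAlg α ⊗[ℝ] ShAlg α) :
    mshT (TensorProduct.map (prep a) LinearMap.id s) (TensorProduct.map (prep b) LinearMap.id t) =
      TensorProduct.map (prep a) LinearMap.id
          (mshT s (TensorProduct.map (prep b) LinearMap.id t)) +
        TensorProduct.map (prep b) LinearMap.id
          (mshT (TensorProduct.map (prep a) LinearMap.id s) t) := by
  induction s using TensorProduct.induction_on with
  | zero => simp
  | add s s' hs hs' => simp only [map_add, mshT_add_left, hs, hs']; abel
  | tmul x y =>
    induction t using TensorProduct.induction_on with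
    | zero => simp
    | add t t' ht ht' => simp only [map_add, mshT_add_right, ht, ht']; abel
    | tmul x' y' =>
      simp only [map_tmul, mshT_tmul, LinearMap.id_apply, shL_prep_prep a b, add_tmul]

theorem deconcat_shL (x y : ShAlg α) :
    deconcat (shL x y) = mshT (deconcat x) (deconcat y) := by
  induction x using ShAlg.induction_prep generalizing y with
  | nil => rw [one_shL, deconcat_one, mshT_one_left]
  | prep a x hx =>
    induction y using ShAlg.induction_prep with
    | nil => rw [shL_one, deconcat_one, mshT_one_right]
    | prep b y hy =>
      rw [shL_prep_prep, map_add, deconcat_prep, deconcat_prep, hx, hy, deconcat_prep,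
        deconcat_prep]
      simp only [mshT_add_left, mshT_add_right, map_add, mshT_tmul, one_shL,
        mshT_map_prep_one_tmul, mshT_one_tmul_map_prep, mshT_map_prep_map_prep,
        shL_prep_prep a b, tmul_add]
      abel
    | add y y' h h' => simp only [map_add, mshT_add_right, h, h']
    | smul r y h => simp only [map_smul, mshT_smul_right, h]
  | add x x' h h' => simp only [map_add, LinearMap.add_apply, mshT_add_left, h, h']
  | smul r x h => simp only [map_smul, LinearMap.smul_apply, mshT_smul_left, h]

theorem counitSh_shL (x y : ShAlg α) : counitSh (shL x y) = counitSh x * counitSh y := by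
  induction x using ShAlg.induction_prep generalizing y with
  | nil => rw [one_shL, counitSh_one, one_mul]
  | prep a x hx =>
    induction y using ShAlg.induction_prep with
    | nil => rw [shL_one, counitSh_one, mul_one]
    | prep b y _ => simp [shL_prep_prep]
    | add y y' h h' => simp only [map_add, h, h', mul_add]
    | smul r y h => simp only [map_smul, h, smul_eq_mul]; ring
  | add x x' h h' => simp only [map_add, LinearMap.add_apply, h, h', add_mul]
  | smul r x h => simp only [map_smul, LinearMap.smul_apply, h, smul_eq_mul]; ring

/-- Appending a letter to every word, extended linearly. -/
def appendLetter (a : α) : ShAlg α →ₗ[ℝ] ShAlg α :=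
  Finsupp.lmapDomain ℝ ℝ (fun w => w ++ [a])

@[simp]
theorem appendLetter_single (a : α) (w : List α) (r : ℝ) :
    appendLetter a (Finsupp.single w r) = Finsupp.single (w ++ [a]) r := by
  simp [appendLetter]

theorem appendLetter_prep (a b : α) (x : ShAlg α) :
    appendLetter a (prep b x) = prep b (appendLetter a x) := by
  induction x using ShAlg.induction <;> simp_all

theorem wsh_append_singleton (a b : α) (u v : List α) :
    wsh (u ++ [a]) (v ++ [b]) =
      appendLetter a (wsh u (v ++ [b])) + appendLetter b (wsh (u ++ [a]) v) := by
  induction u generalizing v with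
  | nil =>
    induction v with
    | nil => simp [wsh_cons_cons, add_comm]
    | cons d v ih =>
      simp only [List.nil_append, List.cons_append] at ih ⊢
      rw [wsh_cons_cons, ih, wsh_cons_cons]
      simp [appendLetter_prep]
      abel
  | cons c u hu =>
    induction v with
    | nil =>
      have h := hu []
      simp only [List.nil_append, List.cons_append] at h ⊢
      rw [wsh_cons_cons, h, wsh_cons_cons]
      simp [appendLetter_prep]
      abel
    | cons d v ih =>
      have h := hu (d :: v)
      simp only [List.cons_append] at h ih ⊢
      rw [wsh_cons_cons, h, ih, wsh_cons_cons, wsh_cons_cons]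
      simp only [map_add, appendLetter_prep]
      abel

/-- Word reversal, extended linearly. -/
def reverseSh : ShAlg α →ₗ[ℝ] ShAlg α :=
  Finsupp.lmapDomain ℝ ℝ List.reverse

@[simp]
theorem reverseSh_single (w : List α) (r : ℝ) :
    reverseSh (Finsupp.single w r) = Finsupp.single w.reverse r := by
  simp [reverseSh]

theorem reverseSh_prep (a : α) (x : ShAlg α) :
    reverseSh (prep a x) = appendLetter a (reverseSh x) := by
  induction x using ShAlg.induction <;> simp_all

theorem reverseSh_wsh (u v : List α) : reverseSh (wsh u v) = wsh u.reverse v.reverse := by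
  induction u generalizing v with
  | nil => simp
  | cons a u hu =>
    induction v with
    | nil => simp
    | cons b v hv =>
      rw [wsh_cons_cons, map_add, reverseSh_prep, reverseSh_prep, hu, hv, List.reverse_cons,
        List.reverse_cons, wsh_append_singleton]

theorem wsh_comm (u v : List α) : wsh u v = wsh v u := by
  rw [← shL_single, shL_comm, shL_single]

/-- The telescoping sum behind the antipode identity. -/
theorem sum_wsh_reverse_take_append (a : α) (u v : List α) :
    ∑ i ∈ Finset.range (v.length + 1),
        (-1 : ℝ) ^ i • wsh ((v.take i).reverse ++ a :: u) (v.drop i) = prep a (wsh u v) := by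
  induction v generalizing a u with
  | nil => simp
  | cons b v ih =>
    rw [List.length_cons, Finset.sum_range_succ']
    have h := ih b (a :: u)
    simp only [List.take_succ_cons, List.drop_succ_cons, List.reverse_cons, List.append_assoc,
      List.singleton_append, pow_succ, mul_neg_one, neg_smul, Finset.sum_neg_distrib, h]
    simp [wsh_cons_cons]

theorem sum_wsh_reverse_take (w : List α) :
    ∑ i ∈ Finset.range (w.length + 1), (-1 : ℝ) ^ i • wsh (w.take i).reverse (w.drop i) =
      counitSh (Finsupp.single w 1) • Finsupp.single [] 1 := by
  cases w with
  | nil => simp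
  | cons b v =>
    rw [List.length_cons, Finset.sum_range_succ']
    have h := sum_wsh_reverse_take_append b [] v
    simp only [List.take_succ_cons, List.drop_succ_cons, List.reverse_cons, pow_succ,
      mul_neg_one, neg_smul, Finset.sum_neg_distrib, h]
    simp [counitSh]

theorem sum_wsh_take_reverse_drop (w : List α) :
    ∑ i ∈ Finset.range (w.length + 1),
        (-1 : ℝ) ^ (w.length - i) • wsh (w.take i) (w.drop i).reverse =
      counitSh (Finsupp.single w 1) • Finsupp.single [] 1 := by
  have h := congrArg reverseSh (sum_wsh_reverse_take w.reverse)
  rw [← Finset.sum_range_reflect, map_sum] at h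
  have hc : counitSh (Finsupp.single w.reverse 1) = counitSh (Finsupp.single w 1) := by
    cases w <;> simp [counitSh]
  rw [hc, map_smul, reverseSh_single, List.reverse_nil, List.length_reverse] at h
  rw [← h]
  refine Finset.sum_congr rfl fun i hi => ?_
  have hi' : i ≤ w.length := Nat.lt_succ_iff.mp (Finset.mem_range.mp hi)
  rw [map_smul, reverseSh_wsh, List.take_reverse, List.drop_reverse, List.reverse_reverse,
    List.reverse_reverse, wsh_comm, show w.length + 1 - 1 - i = w.length - i by omega,
    Nat.sub_sub_self hi']

/-- The antipode of the shuffle algebra: signed reversal of words. -/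
def antipodeSh : ShAlg α →ₗ[ℝ] ShAlg α :=
  Finsupp.lsum ℝ fun w =>
    LinearMap.toSpanSingleton ℝ (ShAlg α) ((-1 : ℝ) ^ w.length • Finsupp.single w.reverse 1)

theorem antipodeSh_single (w : List α) :
    antipodeSh (Finsupp.single w 1) = (-1 : ℝ) ^ w.length • Finsupp.single w.reverse 1 := by
  rw [antipodeSh, Finsupp.lsum_single, LinearMap.toSpanSingleton_apply, one_smul]

theorem msh_map_antipodeSh_id_deconcat (x : ShAlg α) :
    msh (TensorProduct.map antipodeSh LinearMap.id (deconcat x)) =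
      counitSh x • Finsupp.single [] 1 := by
  induction x using ShAlg.induction with
  | word w =>
    rw [deconcat_single, deconcatWord, map_sum, map_sum, ← sum_wsh_reverse_take]
    refine Finset.sum_congr rfl fun i hi => ?_
    have hi' : i ≤ w.length := Nat.lt_succ_iff.mp (Finset.mem_range.mp hi)
    rw [map_tmul, msh_tmul, antipodeSh_single, map_smul, LinearMap.smul_apply,
      LinearMap.id_apply, shL_single, List.length_take, min_eq_left hi']
  | add x y hx hy => simp only [map_add, hx, hy, add_smul]
  | smul r x h => simp only [map_smul, h, smul_assoc]

theorem msh_map_id_antipodeSh_deconcat (x : ShAlg α) :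
    msh (TensorProduct.map LinearMap.id antipodeSh (deconcat x)) =
      counitSh x • Finsupp.single [] 1 := by
  induction x using ShAlg.induction with
  | word w =>
    rw [deconcat_single, deconcatWord, map_sum, map_sum, ← sum_wsh_take_reverse_drop]
    refine Finset.sum_congr rfl fun i _ => ?_
    rw [map_tmul, msh_tmul, antipodeSh_single, map_smul, LinearMap.id_apply, shL_single,
      List.length_drop]
  | add x y hx hy => simp only [map_add, hx, hy, add_smul]
  | smul r x h => simp only [map_smul, h, smul_assoc]

/-- `ℝ⟨A⟩` with the shuffle product, the deconcatenation coproduct,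
unit the empty word and counit `ε` forms a Hopf algebra (the shuffle Hopf algebra), whose
antipode is the signed reversal `S(a₁a₂⋯a_k) = (-1)^k a_k⋯a₂a₁`. -/
theorem shuffle_hopf_algebra (α : Type) :
    -- the shuffle product is associative
    (∀ f g h : ShAlg α, shL (shL f g) h = shL f (shL g h)) ∧
    -- the empty word is a two-sided unit for the shuffle product
    (∀ f : ShAlg α, shL (Finsupp.single [] 1) f = f ∧ shL f (Finsupp.single [] 1) = f) ∧
    -- deconcatenation is coassociative
    (∀ f : ShAlg α,
      (TensorProduct.assoc ℝ (ShAlg α) (ShAlg α) (ShAlg α))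
          ((TensorProduct.map deconcat LinearMap.id) (deconcat f)) =
        (TensorProduct.map LinearMap.id deconcat) (deconcat f)) ∧
    -- counit laws
    (∀ f : ShAlg α,
      (TensorProduct.lid ℝ (ShAlg α))
        ((TensorProduct.map counitSh LinearMap.id) (deconcat f)) = f) ∧
    (∀ f : ShAlg α,
      (TensorProduct.rid ℝ (ShAlg α))
        ((TensorProduct.map LinearMap.id counitSh) (deconcat f)) = f) ∧
    -- the coproduct is an algebra morphism for the shuffle product
    (deconcat (Finsupp.single ([] : List α) (1 : ℝ)) =
      Finsupp.single [] 1 ⊗ₜ[ℝ] Finsupp.single [] 1) ∧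
    (∀ f g : ShAlg α, deconcat (shL f g) = mshT (deconcat f) (deconcat g)) ∧
    -- the counit is an algebra morphism
    (counitSh (Finsupp.single ([] : List α) (1 : ℝ)) = 1) ∧
    (∀ f g : ShAlg α, counitSh (shL f g) = counitSh f * counitSh g) ∧
    -- existence of the antipode, given by signed reversal
    (∃ S : ShAlg α →ₗ[ℝ] ShAlg α,
      (∀ f : ShAlg α,
        msh ((TensorProduct.map S LinearMap.id) (deconcat f)) =
          counitSh f • Finsupp.single [] 1) ∧
      (∀ f : ShAlg α,
        msh ((TensorProduct.map LinearMap.id S) (deconcat f)) =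
          counitSh f • Finsupp.single [] 1) ∧
      (∀ w : List α,
        S (Finsupp.single w 1) =
          ((-1 : ℝ) ^ w.length) • Finsupp.single w.reverse 1)) := by
  exact ⟨shL_assoc, fun f => ⟨one_shL f, shL_one f⟩, deconcat_coassoc, lid_map_counitSh_deconcat,
    rid_map_counitSh_deconcat, deconcat_one, deconcat_shL, counitSh_one, counitSh_shL,
    antipodeSh, msh_map_antipodeSh_id_deconcat, msh_map_id_antipodeSh_deconcat,
    antipodeSh_single⟩

end
end
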